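/- (Energy bounded by the potential) For every L > 0 there exists a constant K_pot(L) > 0 depending only on V and L such that for every ε with 0 < ε ≤ 1 and every solution u_ε of the vectorial Allen–Cahn system on the unit disk D² with sup_{D²(4/5)} |u_ε| ≤ L, one has ∫_{D²(1/2)} e_ε(u_ε) dx ≤ K_pot(L)·[ ∫_{D²(3/4)} ε⁻¹V(u_ε) dx + ε·∫_{D² \ D²(3/4)} e_ε(u_ε) dx ]. -/

import Mathlib

open MeasureTheory Metric Filter Topology Bornology
open scoped RealInnerProductSpace ENNReal Topology

noncomputable section

/-- The euclidean plane. -/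
abbrev E2 : Type := EuclideanSpace ℝ (Fin 2)

/-- The euclidean space `ℝ^k`. -/
abbrev Evec (k : ℕ) : Type := EuclideanSpace ℝ (Fin k)

/-- The `i`-th standard basis vector of the plane. -/
def b2 (i : Fin 2) : E2 := EuclideanSpace.single i (1 : ℝ)

/-- The partial derivative of `u` in the `i`-th coordinate direction. -/
def pder {k : ℕ} (u : E2 → Evec k) (i : Fin 2) (x : E2) : Evec k :=
  fderiv ℝ u x (b2 i)

/-- The Laplacian of a map defined on the plane. -/
def lap {k : ℕ} (u : E2 → Evec k) (x : E2) : Evec k :=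
  ∑ i : Fin 2, fderiv ℝ (pder u i) x (b2 i)

/-- `u` is a smooth solution of the vectorial Allen-Cahn system
`Δu = ε⁻² ∇V(u)` on the open set `U`. -/
def IsSolution {k : ℕ} (V : Evec k → ℝ) (ε : ℝ) (U : Set E2) (u : E2 → Evec k) : Prop :=
  ContDiffOn ℝ (⊤ : ℕ∞) u U ∧ ∀ x ∈ U, lap u x = (ε ^ 2)⁻¹ • gradient V (u x)

/-- The squared modulus `|∇u|²` of the full gradient. -/
def gradSq {k : ℕ} (u : E2 → Evec k) (x : E2) : ℝ :=
  ∑ i : Fin 2, ‖pder u i x‖ ^ 2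

/-- The energy density `e_ε(u) = (ε/2)|∇u|² + ε⁻¹ V(u)`. -/
def eDens {k : ℕ} (V : Evec k → ℝ) (ε : ℝ) (u : E2 → Evec k) (x : E2) : ℝ :=
  ε / 2 * gradSq u x + ε⁻¹ * V (u x)

/-- The energy `E_ε(u, G)`. -/
def energy {k : ℕ} (V : Evec k → ℝ) (ε : ℝ) (u : E2 → Evec k) (G : Set E2) : ℝ :=
  ∫ x in G, eDens V ε u x

/-- The hypotheses (H₁), (H₂), (H₃) on the multi-well potential `V`:
smooth, nonnegative with `inf V = 0`, finitely many zeros (at least two),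
positive definite Hessian at each zero, quadratic growth of `y·∇V(y)` at
infinity and coercivity. -/
structure IsMultiWell {k : ℕ} (V : Evec k → ℝ) : Prop where
  smooth : ContDiff ℝ (⊤ : ℕ∞) V
  nonneg : ∀ y, 0 ≤ V y
  finite_zeros : {y : Evec k | V y = 0}.Finite
  two_le_card : 2 ≤ {y : Evec k | V y = 0}.ncard
  hess_posdef : ∀ σ : Evec k, V σ = 0 → ∀ w : Evec k, w ≠ 0 →
    0 < iteratedFDeriv ℝ 2 V σ ![w, w]
  growth : ∃ α > (0 : ℝ), ∃ R > (0 : ℝ), ∀ y : Evec k, R < ‖y‖ →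
    α * ‖y‖ ^ 2 ≤ ⟪y, gradient V y⟫
  coercive : ∀ C : ℝ, ∃ R : ℝ, ∀ y : Evec k, R ≤ ‖y‖ → C ≤ V y

/-- Second derivative test along the real line, necessary direction. -/
lemma IsLocalMax.second_deriv_nonpos {g g' : ℝ → ℝ} {d : ℝ} (hg : IsLocalMax g 0)
    (h1 : ∀ᶠ t in 𝓝 (0 : ℝ), HasDerivAt g (g' t) t) (h2 : HasDerivAt g' d 0) : d ≤ 0 := by
  by_contra! hd
  have e1 : deriv g =ᶠ[𝓝 0] g' := h1.mono fun t ht => ht.deriv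
  have e2 : deriv (deriv g) 0 = d := by rw [e1.deriv_eq, h2.deriv]
  have hmin : IsLocalMin g 0 :=
    isLocalMin_of_deriv_deriv_pos (by rw [e2]; exact hd) hg.deriv_eq_zero
      h1.self_of_nhds.continuousAt
  have hc : g =ᶠ[𝓝 0] fun _ => g 0 := by
    filter_upwards [hg, hmin] with t ht ht'
    exact le_antisymm ht ht'
  have : deriv (deriv g) 0 = 0 := by
    rw [(hc.deriv).deriv_eq]
    simp
  linarith

lemma pder_contDiffOn {k : ℕ} {u : E2 → Evec k} {U : Set E2} (hU : IsOpen U)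
    (hu : ContDiffOn ℝ (⊤ : ℕ∞) u U) (i : Fin 2) : ContDiffOn ℝ (⊤ : ℕ∞) (pder u i) U := by
  have := hu.fderiv_of_isOpen (m := (⊤ : ℕ∞)) hU (by simp)
  exact this.clm_apply contDiffOn_const

lemma hasFDerivAt_of_contDiffOn {F : Type*} [NormedAddCommGroup F] [NormedSpace ℝ F]
    {f : E2 → F} {U : Set E2} (hU : IsOpen U)
    (hf : ContDiffOn ℝ (⊤ : ℕ∞) f U) {x : E2} (hx : x ∈ U) : HasFDerivAt f (fderiv ℝ f x) x :=
  ((hf.contDiffAt (hU.mem_nhds hx)).differentiableAt (by simp)).hasFDerivAt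

lemma hasDerivAt_line {k : ℕ} {u : E2 → Evec k} {U : Set E2} (hU : IsOpen U)
    (hu : ContDiffOn ℝ (⊤ : ℕ∞) u U) (x : E2) (j : Fin 2) {t : ℝ} (ht : x + t • b2 j ∈ U) :
    HasDerivAt (fun s : ℝ => u (x + s • b2 j)) (pder u j (x + t • b2 j)) t := by
  have h1 : HasDerivAt (fun s : ℝ => x + s • b2 j) (b2 j) t := by
    simpa using ((hasDerivAt_id t).smul_const (b2 j)).const_add x
  exact (hasFDerivAt_of_contDiffOn hU hu ht).comp_hasDerivAt t h1

lemma eventually_line {U : Set E2} (hU : IsOpen U) {x : E2} (hx : x ∈ U) (j : Fin 2) :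
    ∀ᶠ t : ℝ in 𝓝 0, x + t • b2 j ∈ U := by
  have : Continuous fun t : ℝ => x + t • b2 j := by fun_prop
  exact this.continuousAt.eventually_mem (hU.mem_nhds (by simpa using hx))

lemma pder_comm {k : ℕ} {u : E2 → Evec k} {U : Set E2} (hU : IsOpen U)
    (hu : ContDiffOn ℝ (⊤ : ℕ∞) u U) (i j : Fin 2) {x : E2} (hx : x ∈ U) :
    pder (pder u i) j x = pder (pder u j) i x := by
  have hd : DifferentiableAt ℝ (fderiv ℝ u) x :=
    ((hu.fderiv_of_isOpen (m := (⊤ : ℕ∞)) hU (by simp)).contDiffAt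
      (hU.mem_nhds hx)).differentiableAt (by simp)
  have hs : IsSymmSndFDerivAt ℝ u x :=
    (hu.contDiffAt (hU.mem_nhds hx)).isSymmSndFDerivAt
      (by simpa using WithTop.coe_le_coe.2 (le_top : (2 : ℕ∞) ≤ ⊤))
  have key : ∀ i j : Fin 2, pder (pder u i) j x = fderiv ℝ (fderiv ℝ u) x (b2 j) (b2 i) := by
    intro i j
    have : HasFDerivAt (pder u i) _ x := hd.hasFDerivAt.clm_apply (hasFDerivAt_const (b2 i) x)
    rw [pder, this.fderiv]
    simp
  rw [key, key]
  exact hs _ _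

lemma pder_congr {k : ℕ} {u v : E2 → Evec k} {U : Set E2} (hU : IsOpen U)
    (h : ∀ y ∈ U, u y = v y) (i : Fin 2) {x : E2} (hx : x ∈ U) : pder u i x = pder v i x := by
  have : u =ᶠ[𝓝 x] v := Filter.eventually_of_mem (hU.mem_nhds hx) h
  rw [pder, pder, this.fderiv_eq]

/-- The Laplacian commutes with partial derivatives. -/
lemma lap_pder {k : ℕ} {u : E2 → Evec k} {U : Set E2} (hU : IsOpen U)
    (hu : ContDiffOn ℝ (⊤ : ℕ∞) u U) (i : Fin 2) {x : E2} (hx : x ∈ U) :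
    lap (pder u i) x = pder (lap u) i x := by
  have hterm : ∀ j : Fin 2, pder (pder (pder u i) j) j x = pder (pder (pder u j) j) i x := by
    intro j
    rw [pder_congr hU (fun y hy => pder_comm hU hu i j hy) j hx,
      pder_comm hU (pder_contDiffOn hU hu j) i j hx]
  have hs : HasFDerivAt (lap u) (∑ j : Fin 2, fderiv ℝ (pder (pder u j) j) x) x := by
    have := HasFDerivAt.fun_sum (u := Finset.univ) fun (j : Fin 2) _ =>
      hasFDerivAt_of_contDiffOn hU (pder_contDiffOn hU (pder_contDiffOn hU hu j) j) hx
    exact this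
  change ∑ j, pder (pder (pder u i) j) j x = _
  rw [pder, hs.fderiv]
  simp only [sum_apply]
  exact Finset.sum_congr rfl fun j _ => hterm j

/-- Bernstein-type inequality along a line, at a local maximum of
`q² (|a|² + |b|²) + κ |u|²`. -/
lemma bernstein_line {F : Type*} [NormedAddCommGroup F] [InnerProductSpace ℝ F]
    {q q' : ℝ → ℝ} {a a' b b' u u' : ℝ → F} {q₂ κ : ℝ} {a₂ b₂ u₂ : F}
    (hq : ∀ᶠ t in 𝓝 (0 : ℝ), HasDerivAt q (q' t) t) (hq₂ : HasDerivAt q' q₂ 0)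
    (ha : ∀ᶠ t in 𝓝 (0 : ℝ), HasDerivAt a (a' t) t) (ha₂ : HasDerivAt a' a₂ 0)
    (hb : ∀ᶠ t in 𝓝 (0 : ℝ), HasDerivAt b (b' t) t) (hb₂ : HasDerivAt b' b₂ 0)
    (hu : ∀ᶠ t in 𝓝 (0 : ℝ), HasDerivAt u (u' t) t) (hu₂ : HasDerivAt u' u₂ 0)
    (hmax : IsLocalMax
      (fun t => q t ^ 2 * (‖a t‖ ^ 2 + ‖b t‖ ^ 2) + κ * ‖u t‖ ^ 2) 0) :
    (-6 * q' 0 ^ 2 + 2 * q 0 * q₂) * (‖a 0‖ ^ 2 + ‖b 0‖ ^ 2)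
      + 2 * q 0 ^ 2 * (⟪a 0, a₂⟫ + ⟪b 0, b₂⟫) + κ * (2 * ‖u' 0‖ ^ 2 + 2 * ⟪u 0, u₂⟫) ≤ 0 := by
  have h1 : ∀ᶠ t in 𝓝 (0 : ℝ), HasDerivAt
      (fun t => q t ^ 2 * (‖a t‖ ^ 2 + ‖b t‖ ^ 2) + κ * ‖u t‖ ^ 2)
      ((2 * q t * q' t) * (‖a t‖ ^ 2 + ‖b t‖ ^ 2)
        + q t ^ 2 * (2 * ⟪a t, a' t⟫ + 2 * ⟪b t, b' t⟫) + κ * (2 * ⟪u t, u' t⟫)) t := by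
    filter_upwards [hq, ha, hb, hu] with t hq ha hb hu
    have := ((hq.fun_pow 2).fun_mul (ha.norm_sq.fun_add hb.norm_sq)).fun_add
      (hu.norm_sq.const_mul κ)
    exact this.congr_deriv (by norm_num)
  have q0 := hq.self_of_nhds
  have a0 := ha.self_of_nhds
  have b0 := hb.self_of_nhds
  have u0 := hu.self_of_nhds
  have h2 := ((((q0.const_mul 2).fun_mul hq₂).fun_mul (a0.norm_sq.fun_add b0.norm_sq)).fun_add
    ((q0.fun_pow 2).fun_mul (((a0.inner ℝ ha₂).const_mul 2).fun_add
      ((b0.inner ℝ hb₂).const_mul 2)))).fun_add (((u0.inner ℝ hu₂).const_mul 2).const_mul κ)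
  have h3 := hmax.second_deriv_nonpos h1 h2
  have sq : ∀ v w : F, 0 ≤ q 0 ^ 2 * ‖w‖ ^ 2 + 4 * (q 0 * q' 0) * ⟪v, w⟫
      + 4 * q' 0 ^ 2 * ‖v‖ ^ 2 := by
    intro v w
    have := norm_add_sq_real (q 0 • w) ((2 * q' 0) • v)
    rw [norm_smul, norm_smul, inner_smul_left, inner_smul_right, mul_pow, mul_pow,
      Real.norm_eq_abs, Real.norm_eq_abs, sq_abs, sq_abs, real_inner_comm] at this
    simp only [conj_trivial] at this
    nlinarith [sq_nonneg ‖q 0 • w + (2 * q' 0) • v‖]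
  have sa := sq (a 0) (a' 0)
  have sb := sq (b 0) (b' 0)
  simp only [real_inner_self_eq_norm_sq] at h3
  norm_num at h3
  nlinarith

lemma inner_gradient_eq {k : ℕ} (V : Evec k → ℝ) (y w : Evec k) :
    ⟪w, gradient V y⟫ = fderiv ℝ V y w := by
  rw [real_inner_comm, gradient, InnerProductSpace.toDual_symm_apply]

lemma IsSolution.inner_lap {k : ℕ} {V : Evec k → ℝ} {ε : ℝ} {U : Set E2} {u : E2 → Evec k}
    (hu : IsSolution V ε U u) {x : E2} (hx : x ∈ U) (w : Evec k) :
    ⟪w, lap u x⟫ = (ε ^ 2)⁻¹ * fderiv ℝ V (u x) w := by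
  rw [hu.2 x hx, inner_smul_right, inner_gradient_eq]

/-- The linearized equation satisfied by the partial derivatives of a solution. -/
lemma IsSolution.inner_lap_pder {k : ℕ} {V : Evec k → ℝ} (hV : ContDiff ℝ (⊤ : ℕ∞) V) {ε : ℝ}
    {U : Set E2} (hU : IsOpen U) {u : E2 → Evec k} (hu : IsSolution V ε U u) {x : E2}
    (hx : x ∈ U) (i : Fin 2) (w : Evec k) :
    ⟪w, lap (pder u i) x⟫ =
      (ε ^ 2)⁻¹ * fderiv ℝ (fderiv ℝ V) (u x) (pder u i x) w := by
  have hd : HasFDerivAt (fderiv ℝ V) (fderiv ℝ (fderiv ℝ V) (u x)) (u x) :=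
    ((hV.fderiv_right (m := (⊤ : ℕ∞)) (by simp)).differentiable (by simp) (u x)).hasFDerivAt
  have h1 := hd.comp x (hasFDerivAt_of_contDiffOn hU hu.1 hx)
  have h2 := (((InnerProductSpace.toDual ℝ (Evec k)).symm.toContinuousLinearEquiv.toContinuousLinearMap.hasFDerivAt).comp
    x h1).const_smul ((ε ^ 2)⁻¹)
  have h3 : pder (fun y => (ε ^ 2)⁻¹ • gradient V (u y)) i x = (ε ^ 2)⁻¹ •
      (InnerProductSpace.toDual ℝ (Evec k)).symm
        (fderiv ℝ (fderiv ℝ V) (u x) (pder u i x)) := by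
    rw [pder]
    erw [h2.fderiv]
    rfl
  rw [lap_pder hU hu.1 i hx, pder_congr hU hu.2 i hx, h3, inner_smul_right, real_inner_comm,
    InnerProductSpace.toDual_symm_apply]

lemma inner_b2 (x : E2) (j : Fin 2) : ⟪x, b2 j⟫ = x j := by
  simp [b2, EuclideanSpace.inner_single_right]

lemma hasDerivAt_sub_norm_sq_line (c : ℝ) (x : E2) (j : Fin 2) (t : ℝ) :
    HasDerivAt (fun s : ℝ => c - ‖x + s • b2 j‖ ^ 2) (-2 * (x j + t)) t := by
  have h1 : HasDerivAt (fun s : ℝ => x + s • b2 j) (b2 j) t := by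
    simpa using ((hasDerivAt_id t).smul_const (b2 j)).const_add x
  refine (h1.norm_sq.const_sub c).congr_deriv ?_
  rw [inner_b2]
  simp [b2]

lemma gradSq_nonneg {k : ℕ} (u : E2 → Evec k) (x : E2) : 0 ≤ gradSq u x :=
  Finset.sum_nonneg fun _ _ => by positivity

/-- The scalar computation at a maximum point in Bernstein's argument. -/
lemma bernstein_max_bound {M L N e X x₀ x₁ P p₀ p₁ d h₀ h₁ a₀ a₁ b₀ b₁ c₀ c₁ : ℝ}
    (hM : 0 ≤ M) (he : 1 ≤ e) (hX : 0 ≤ X) (hX' : X ≤ 16 / 25) (hx : X = x₀ ^ 2 + x₁ ^ 2)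
    (hP : 0 ≤ P) (hp : P = p₀ + p₁)
    (l₀ : (-6 * (-2 * x₀) ^ 2 + 2 * (16 / 25 - X) * (-2)) * P
      + 2 * (16 / 25 - X) ^ 2 * (a₀ + b₀) + ((13 + M) * e) * (2 * p₀ + 2 * c₀) ≤ 0)
    (l₁ : (-6 * (-2 * x₁) ^ 2 + 2 * (16 / 25 - X) * (-2)) * P
      + 2 * (16 / 25 - X) ^ 2 * (a₁ + b₁) + ((13 + M) * e) * (2 * p₁ + 2 * c₁) ≤ 0)
    (ha : a₀ + a₁ = e * h₀) (hb : b₀ + b₁ = e * h₁) (hc : c₀ + c₁ = e * d)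
    (hH : -(M * P) ≤ h₀ + h₁) (hd : -(L * N) ≤ d) : P ≤ (13 + M) * L * N * e := by
  obtain ⟨q, hq⟩ : ∃ q, q = 16 / 25 - X := ⟨_, rfl⟩
  rw [← hq] at l₀ l₁
  have hq2 : q ^ 2 ≤ 1 := pow_le_one₀ (by linarith) (by linarith)
  have key : (-24 * X - 8 * q) * P + 2 * q ^ 2 * (e * (h₀ + h₁))
      + ((13 + M) * e) * (2 * P + 2 * (e * d)) ≤ 0 := by
    linear_combination l₀ + l₁ - 2 * q ^ 2 * (ha + hb) - (13 + M) * e * 2 * hc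
      + (13 + M) * e * 2 * hp - 24 * P * hx
  have t1 : -24 * P ≤ (-24 * X - 8 * q) * P :=
    mul_le_mul_of_nonneg_right (by linarith) hP
  have t2 : -(2 * e * (M * P)) ≤ 2 * q ^ 2 * (e * (h₀ + h₁)) := by
    have a1 : 2 * q ^ 2 * e * (-(M * P)) ≤ 2 * q ^ 2 * e * (h₀ + h₁) :=
      mul_le_mul_of_nonneg_left hH (by positivity)
    have a2 : q ^ 2 * (e * (M * P)) ≤ 1 * (e * (M * P)) :=
      mul_le_mul_of_nonneg_right hq2 (by positivity)
    linarith
  have t3 : (13 + M) * e * (2 * (e * -(L * N))) ≤ (13 + M) * e * (2 * (e * d)) := by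
    gcongr
  have t4 : P ≤ e * P := le_mul_of_one_le_left hP he
  have : e * P ≤ e * ((13 + M) * L * N * e) := by linarith
  exact le_of_mul_le_mul_left this (by linarith)

/-- At an interior maximum of the Bernstein function the gradient is controlled. -/
lemma gradSq_le_of_isLocalMax {k : ℕ} {V : Evec k → ℝ} (hV : ContDiff ℝ (⊤ : ℕ∞) V)
    {ε M N L : ℝ} (hε : 0 < ε) (hε1 : ε ≤ 1) {u : E2 → Evec k}
    (hu : IsSolution V ε (ball (0 : E2) 1) u) {x : E2} (hx : x ∈ ball (0 : E2) (4 / 5))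
    (hL : ‖u x‖ ≤ L) (hM : ‖fderiv ℝ (fderiv ℝ V) (u x)‖ ≤ M)
    (hN : ‖fderiv ℝ V (u x)‖ ≤ N) (hmax : IsLocalMax (fun y => (16 / 25 - ‖y‖ ^ 2) ^ 2 *
      gradSq u y + ((13 + M) * (ε ^ 2)⁻¹) * ‖u y‖ ^ 2) x) :
    gradSq u x ≤ (13 + M) * L * N * (ε ^ 2)⁻¹ := by
  have hx1 : x ∈ ball (0 : E2) 1 := ball_subset_ball (by norm_num) hx
  have hO : IsOpen (ball (0 : E2) 1) := isOpen_ball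
  have hp := fun i => pder_contDiffOn hO hu.1 i
  have hxn : ‖x‖ < 4 / 5 := by simpa using hx
  have line : ∀ j : Fin 2,
      (-6 * (-2 * x j) ^ 2 + 2 * (16 / 25 - ‖x‖ ^ 2) * (-2)) * gradSq u x
        + 2 * (16 / 25 - ‖x‖ ^ 2) ^ 2 * (⟪pder u 0 x, pder (pder (pder u 0) j) j x⟫
          + ⟪pder u 1 x, pder (pder (pder u 1) j) j x⟫)
        + ((13 + M) * (ε ^ 2)⁻¹) * (2 * ‖pder u j x‖ ^ 2
          + 2 * ⟪u x, pder (pder u j) j x⟫) ≤ 0 := by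
    intro j
    have ev := eventually_line hO hx1 j
    have h0 : x + (0 : ℝ) • b2 j ∈ ball (0 : E2) 1 := by simpa using hx1
    have hcont : Tendsto (fun t : ℝ => x + t • b2 j) (𝓝 0) (𝓝 x) := by
      have : Continuous fun t : ℝ => x + t • b2 j := by fun_prop
      simpa using this.tendsto 0
    have hq2 : HasDerivAt (fun t : ℝ => -2 * (x j + t)) (-2) 0 := by
      simpa using ((hasDerivAt_id (0 : ℝ)).const_add (x j)).const_mul (-2)
    have := bernstein_line (κ := (13 + M) * (ε ^ 2)⁻¹)
      (Eventually.of_forall fun t => hasDerivAt_sub_norm_sq_line (16 / 25) x j t) hq2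
      (ev.mono fun t ht => hasDerivAt_line hO (hp 0) x j ht)
      (hasDerivAt_line hO (pder_contDiffOn hO (hp 0) j) x j h0)
      (ev.mono fun t ht => hasDerivAt_line hO (hp 1) x j ht)
      (hasDerivAt_line hO (pder_contDiffOn hO (hp 1) j) x j h0)
      (ev.mono fun t ht => hasDerivAt_line hO hu.1 x j ht)
      (hasDerivAt_line hO (hp j) x j h0)
      (by
        have := hcont.eventually hmax
        filter_upwards [this] with t ht
        simpa [gradSq, Fin.sum_univ_two] using ht)
    simpa [gradSq, Fin.sum_univ_two] using this
  have l0 := line 0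
  have l1 := line 1
  have s0 := hu.inner_lap_pder hV hO hx1 0 (pder u 0 x)
  have s1 := hu.inner_lap_pder hV hO hx1 1 (pder u 1 x)
  have su := hu.inner_lap hx1 (u x)
  change ⟪_, ∑ j, pder (pder (pder u 0) j) j x⟫ = _ at s0
  change ⟪_, ∑ j, pder (pder (pder u 1) j) j x⟫ = _ at s1
  change ⟪_, ∑ j, pder (pder u j) j x⟫ = _ at su
  rw [Fin.sum_univ_two, inner_add_right] at s0 s1 su
  have nx : ‖x‖ ^ 2 = x 0 ^ 2 + x 1 ^ 2 := by
    rw [EuclideanSpace.real_norm_sq_eq, Fin.sum_univ_two]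
  have hH : ∀ w : Evec k, -(M * ‖w‖ ^ 2) ≤ fderiv ℝ (fderiv ℝ V) (u x) w w := by
    intro w
    have h := (fderiv ℝ (fderiv ℝ V) (u x)).le_opNorm₂ w w
    rw [Real.norm_eq_abs] at h
    have h' := (abs_le.1 h).1
    nlinarith [mul_le_mul_of_nonneg_right hM (sq_nonneg ‖w‖)]
  have hL0 : 0 ≤ L := (norm_nonneg _).trans hL
  have hM0 : 0 ≤ M := (norm_nonneg (fderiv ℝ (fderiv ℝ V) (u x))).trans hM
  have hDV : -(L * N) ≤ fderiv ℝ V (u x) (u x) := by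
    have h := (fderiv ℝ V (u x)).le_opNorm (u x)
    rw [Real.norm_eq_abs] at h
    have h' := (abs_le.1 h).1
    have := mul_le_mul hL hN (norm_nonneg _) hL0
    nlinarith
  have H0 := hH (pder u 0 x)
  have H1 := hH (pder u 1 x)
  have hP : gradSq u x = ‖pder u 0 x‖ ^ 2 + ‖pder u 1 x‖ ^ 2 := by
    simp [gradSq, Fin.sum_univ_two]
  have he : 1 ≤ (ε ^ 2)⁻¹ := (one_le_inv₀ (by positivity)).2 (pow_le_one₀ hε.le hε1)
  exact bernstein_max_bound hM0 he (sq_nonneg _) (by nlinarith [norm_nonneg x]) nx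
    (gradSq_nonneg u x) hP l0 l1 s0 s1 su (by rw [hP]; linarith) hDV

lemma gradSq_continuousOn {k : ℕ} {u : E2 → Evec k} {U : Set E2} (hU : IsOpen U)
    (hu : ContDiffOn ℝ (⊤ : ℕ∞) u U) : ContinuousOn (gradSq u) U := by
  unfold gradSq
  exact continuousOn_finsetSum _ fun i _ => ((pder_contDiffOn hU hu i).continuousOn.norm.pow 2)

/-- Interior gradient bound for bounded solutions. -/
lemma exists_gradSq_le {k : ℕ} {V : Evec k → ℝ} (hV : ContDiff ℝ (⊤ : ℕ∞) V) {L : ℝ}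
    (hL : 0 < L) : ∃ C : ℝ, 0 ≤ C ∧ ∀ ε : ℝ, 0 < ε → ε ≤ 1 →
      ∀ u : E2 → Evec k, IsSolution V ε (ball (0 : E2) 1) u →
        (∀ x ∈ ball (0 : E2) (4 / 5), ‖u x‖ ≤ L) →
        ∀ x ∈ closedBall (0 : E2) (3 / 4), gradSq u x ≤ C * (ε ^ 2)⁻¹ := by
  have hV1 := hV.fderiv_right (m := (⊤ : ℕ∞)) (by simp)
  have hV2 := hV1.fderiv_right (m := (⊤ : ℕ∞)) (by simp)
  have hK : IsCompact (closedBall (0 : Evec k) L) := isCompact_closedBall _ _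
  obtain ⟨M, hM⟩ := hK.exists_bound_of_continuousOn hV2.continuous.continuousOn
  obtain ⟨N, hN⟩ := hK.exists_bound_of_continuousOn hV1.continuous.continuousOn
  have hM0 : 0 ≤ M := (norm_nonneg _).trans (hM 0 (by simpa using hL.le))
  have hN0 : 0 ≤ N := (norm_nonneg _).trans (hN 0 (by simpa using hL.le))
  refine ⟨(400 / 31) ^ 2 * ((13 + M) * L * N + (13 + M) * L ^ 2), by positivity, ?_⟩
  intro ε hε hε1 u hu hub x hx
  set e := (ε ^ 2)⁻¹ with hedef
  have he : 0 < e := by positivity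
  have hO : IsOpen (ball (0 : E2) 1) := isOpen_ball
  have hsub : closedBall (0 : E2) (4 / 5) ⊆ ball 0 1 := closedBall_subset_ball (by norm_num)
  have hub' : ∀ y ∈ closedBall (0 : E2) (4 / 5), ‖u y‖ ≤ L := by
    have hc : ContinuousOn (fun y => ‖u y‖) (closedBall (0 : E2) (4 / 5)) :=
      (hu.1.continuousOn.mono hsub).norm
    rw [← closure_ball (0 : E2) (by norm_num : (4 / 5 : ℝ) ≠ 0)] at hc ⊢
    intro y hy
    exact le_on_closure hub hc continuousOn_const hy
  have hmem : ∀ y ∈ closedBall (0 : E2) (4 / 5), u y ∈ closedBall (0 : Evec k) L := fun y hy => by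
    simpa using hub' y hy
  set w : E2 → ℝ := fun y => (16 / 25 - ‖y‖ ^ 2) ^ 2 * gradSq u y + ((13 + M) * e) * ‖u y‖ ^ 2
    with hw
  have hwc : ContinuousOn w (closedBall (0 : E2) (4 / 5)) := by
    have h1 := (gradSq_continuousOn hO hu.1).mono hsub
    have h2 := hu.1.continuousOn.mono hsub
    fun_prop
  obtain ⟨z, hz, hzmax⟩ := (isCompact_closedBall (0 : E2) (4 / 5)).exists_isMaxOn
    ⟨0, by simp; norm_num⟩ hwc
  have huz : ‖u z‖ ^ 2 ≤ L ^ 2 := pow_le_pow_left₀ (norm_nonneg _) (hub' z hz) 2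
  have hterm : ((13 + M) * e) * ‖u z‖ ^ 2 ≤ ((13 + M) * e) * L ^ 2 := by gcongr
  have hwz : w z ≤ ((13 + M) * L * N + (13 + M) * L ^ 2) * e := by
    rcases eq_or_lt_of_le (mem_closedBall_zero_iff.1 hz) with hb | hi
    · have : w z = ((13 + M) * e) * ‖u z‖ ^ 2 := by
        simp only [hw, hb]; norm_num
      have h0 : 0 ≤ (13 + M) * L * N * e := by positivity
      nlinarith
    · have hzi : z ∈ ball (0 : E2) (4 / 5) := by simpa using hi
      have hlm : IsLocalMax w z :=
        hzmax.isLocalMax (Filter.mem_of_superset (isOpen_ball.mem_nhds hzi) ball_subset_closedBall)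
      have hg := gradSq_le_of_isLocalMax hV hε hε1 hu hzi (hub' z hz) (hM _ (hmem z hz))
        (hN _ (hmem z hz)) hlm
      have hq : (16 / 25 - ‖z‖ ^ 2) ^ 2 ≤ 1 :=
        pow_le_one₀ (by nlinarith [norm_nonneg z]) (by nlinarith [norm_nonneg z])
      have := mul_le_mul hq hg (gradSq_nonneg u z) zero_le_one
      have hwz : w z = (16 / 25 - ‖z‖ ^ 2) ^ 2 * gradSq u z + ((13 + M) * e) * ‖u z‖ ^ 2 := rfl
      linarith
  have hx' : ‖x‖ ≤ 3 / 4 := by simpa using hx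
  have hwx : w x ≤ w z := hzmax (closedBall_subset_closedBall (by norm_num) hx)
  have hq : 31 / 400 ≤ 16 / 25 - ‖x‖ ^ 2 := by nlinarith [norm_nonneg x]
  have hq2 : (31 / 400 : ℝ) ^ 2 ≤ (16 / 25 - ‖x‖ ^ 2) ^ 2 := pow_le_pow_left₀ (by norm_num) hq 2
  have h1 : (31 / 400 : ℝ) ^ 2 * gradSq u x ≤ w x := by
    have := mul_le_mul_of_nonneg_right hq2 (gradSq_nonneg u x)
    have h2 : 0 ≤ ((13 + M) * e) * ‖u x‖ ^ 2 := by positivity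
    have hwx : w x = (16 / 25 - ‖x‖ ^ 2) ^ 2 * gradSq u x + ((13 + M) * e) * ‖u x‖ ^ 2 := rfl
    linarith
  nlinarith

/-- On bounded sets the Hessian of a multi-well potential is coercive up to a multiple of the
potential. -/
lemma IsMultiWell.exists_hessian_lower_bound {k : ℕ} {V : Evec k → ℝ} (hV : IsMultiWell V)
    (L : ℝ) : ∃ c > (0 : ℝ), ∃ K : ℝ, 0 ≤ K ∧ ∀ y : Evec k, ‖y‖ ≤ L → ∀ w : Evec k,
      c * ‖w‖ ^ 2 ≤ fderiv ℝ (fderiv ℝ V) y w w + K * V y * ‖w‖ ^ 2 := by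
  have hV1 := hV.smooth.fderiv_right (m := (⊤ : ℕ∞)) (by simp)
  have hV2 := (hV1.fderiv_right (m := (⊤ : ℕ∞)) (by simp)).continuous
  have hV0 := hV.smooth.continuous
  have hK : IsCompact (closedBall (0 : Evec k) L ×ˢ sphere (0 : Evec k) 1) :=
    (isCompact_closedBall _ _).prod (isCompact_sphere _ _)
  obtain ⟨n, hn⟩ := hK.elim_directed_cover
    (fun n : ℕ => {p : Evec k × Evec k |
      1 / ((n : ℝ) + 1) < fderiv ℝ (fderiv ℝ V) p.1 p.2 p.2 + n * V p.1})
    (fun n => isOpen_lt (by fun_prop) (by fun_prop))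
    (by
      rintro ⟨y, w⟩ ⟨-, hw⟩
      have hw0 : w ≠ 0 := by rintro rfl; simp at hw
      simp only [Set.mem_iUnion, Set.mem_ofPred_eq]
      rcases (hV.nonneg y).eq_or_lt with h | h
      · have := hV.hess_posdef y h.symm w hw0
        rw [iteratedFDeriv_two_apply] at this
        obtain ⟨n, hn⟩ := exists_nat_one_div_lt this
        exact ⟨n, by simpa [← h] using hn⟩
      · obtain ⟨n, hn⟩ := exists_nat_gt ((1 - fderiv ℝ (fderiv ℝ V) y w w) / V y)
        rw [div_lt_iff₀ h] at hn
        refine ⟨n, ?_⟩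
        have : 1 / ((n : ℝ) + 1) ≤ 1 := by
          rw [div_le_one (by positivity)]
          linarith [(Nat.cast_nonneg n : (0 : ℝ) ≤ n)]
        linarith)
    (directed_of_isDirected_le fun m n hmn p hp => by
      simp only [Set.mem_ofPred_eq] at hp ⊢
      have h1 : (m : ℝ) ≤ n := by exact_mod_cast hmn
      have h2 : 1 / ((n : ℝ) + 1) ≤ 1 / ((m : ℝ) + 1) := by gcongr
      have h3 := mul_le_mul_of_nonneg_right h1 (hV.nonneg p.1)
      linarith)
  refine ⟨1 / ((n : ℝ) + 1), by positivity, n, by positivity, fun y hy w => ?_⟩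
  rcases eq_or_ne w 0 with rfl | hw
  · simp
  have hwn : 0 < ‖w‖ := norm_pos_iff.2 hw
  have h := hn (show (y, (‖w‖⁻¹ : ℝ) • w) ∈ _ from
    ⟨by simpa using hy, by simp [norm_smul, hwn.ne']⟩)
  simp only [Set.mem_ofPred_eq, map_smul, smul_apply, smul_eq_mul] at h
  have h' := mul_lt_mul_of_pos_right h (by positivity : 0 < ‖w‖ ^ 2)
  have e : (‖w‖⁻¹ * (‖w‖⁻¹ * fderiv ℝ (fderiv ℝ V) y w w) + n * V y) * ‖w‖ ^ 2
      = fderiv ℝ (fderiv ℝ V) y w w + n * V y * ‖w‖ ^ 2 := by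
    field_simp
  rw [e] at h'
  exact h'.le

lemma integrable_mul_of_tsupport_subset {g h : E2 → ℝ} (hg : Continuous g)
    (hgs : tsupport g ⊆ closedBall 0 (5 / 8)) (hh : ContinuousOn h (ball 0 1)) :
    Integrable fun x => g x * h x := by
  have h1 : IntegrableOn (fun x => g x * h x) (closedBall (0 : E2) (5 / 8)) :=
    (hg.continuousOn.mul (hh.mono (closedBall_subset_ball (by norm_num)))).integrableOn_compact
      (isCompact_closedBall _ _)
  refine (integrableOn_iff_integrable_of_support_subset ?_).1 h1
  exact (Function.support_mul_subset_left g h).trans ((subset_tsupport g).trans hgs)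

lemma contDiffOn_fderiv_apply {f : E2 → ℝ} {U : Set E2} (hU : IsOpen U)
    (hf : ContDiffOn ℝ (⊤ : ℕ∞) f U) (v : E2) :
    ContDiffOn ℝ (⊤ : ℕ∞) (fun x => fderiv ℝ f x v) U :=
  (hf.fderiv_of_isOpen (m := (⊤ : ℕ∞)) hU (by simp)).clm_apply contDiffOn_const

lemma integral_mul_fderiv_eq_neg {φ f : E2 → ℝ} (hφ : ContDiff ℝ (⊤ : ℕ∞) φ)
    (hφs : tsupport φ ⊆ closedBall 0 (5 / 8)) (hf : ContDiffOn ℝ (⊤ : ℕ∞) f (ball 0 1))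
    (v : E2) : ∫ x, φ x * fderiv ℝ f x v = -∫ x, fderiv ℝ φ x v * f x := by
  refine integral_mul_fderiv_eq_neg_fderiv_mul_of_integrable
    (integrable_mul_of_tsupport_subset ?_ ((tsupport_fderiv_apply_subset ℝ v).trans hφs)
      hf.continuousOn)
    (integrable_mul_of_tsupport_subset hφ.continuous hφs
      (contDiffOn_fderiv_apply isOpen_ball hf v).continuousOn)
    (integrable_mul_of_tsupport_subset hφ.continuous hφs hf.continuousOn)
    (fun x _ => hφ.differentiable (by simp) x)
    (fun x hx => (hasFDerivAt_of_contDiffOn isOpen_ball hf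
      (closedBall_subset_ball (by norm_num) (hφs hx))).differentiableAt)
  exact (contDiffOn_univ.1 (contDiffOn_fderiv_apply isOpen_univ hφ.contDiffOn v)).continuous

lemma integral_mul_fderiv_fderiv_eq {φ f : E2 → ℝ} (hφ : ContDiff ℝ (⊤ : ℕ∞) φ)
    (hφs : tsupport φ ⊆ closedBall 0 (5 / 8)) (hf : ContDiffOn ℝ (⊤ : ℕ∞) f (ball 0 1))
    (v : E2) : ∫ x, φ x * fderiv ℝ (fun y => fderiv ℝ f y v) x v =
      ∫ x, fderiv ℝ (fun y => fderiv ℝ φ y v) x v * f x := by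
  have hφ' : ContDiff ℝ (⊤ : ℕ∞) fun y => fderiv ℝ φ y v :=
    contDiffOn_univ.1 (contDiffOn_fderiv_apply isOpen_univ hφ.contDiffOn v)
  rw [integral_mul_fderiv_eq_neg hφ hφs (contDiffOn_fderiv_apply isOpen_ball hf v) v,
    integral_mul_fderiv_eq_neg hφ' ((tsupport_fderiv_apply_subset ℝ v).trans hφs) hf v, neg_neg]

/-- The Laplacian of `V ∘ u` controls the Hessian term along a solution. -/
lemma IsSolution.sum_hessian_le {k : ℕ} {V : Evec k → ℝ} (hV : ContDiff ℝ (⊤ : ℕ∞) V) {ε : ℝ}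
    {U : Set E2} (hU : IsOpen U) {u : E2 → Evec k} (hu : IsSolution V ε U u) {x : E2}
    (hx : x ∈ U) :
    ∑ j, fderiv ℝ (fderiv ℝ V) (u x) (pder u j x) (pder u j x) ≤
      ∑ j, fderiv ℝ (fun y => fderiv ℝ (fun z => V (u z)) y (b2 j)) x (b2 j) := by
  have hV' : ∀ y, HasFDerivAt V (fderiv ℝ V y) y := fun y =>
    (hV.differentiable (by simp) y).hasFDerivAt
  have hd : HasFDerivAt (fderiv ℝ V) (fderiv ℝ (fderiv ℝ V) (u x)) (u x) :=
    ((hV.fderiv_right (m := (⊤ : ℕ∞)) (by simp)).differentiable (by simp) (u x)).hasFDerivAt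
  have h1 : ∀ j, ∀ y ∈ U, fderiv ℝ (fun z => V (u z)) y (b2 j) = fderiv ℝ V (u y) (pder u j y) := by
    intro j y hy
    have : HasFDerivAt (fun z => V (u z)) _ y :=
      (hV' (u y)).comp y (hasFDerivAt_of_contDiffOn hU hu.1 hy)
    rw [this.fderiv]
    rfl
  have h2 : ∀ j, fderiv ℝ (fun y => fderiv ℝ (fun z => V (u z)) y (b2 j)) x (b2 j)
      = fderiv ℝ (fderiv ℝ V) (u x) (pder u j x) (pder u j x)
        + fderiv ℝ V (u x) (pder (pder u j) j x) := by
    intro j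
    have e : (fun y => fderiv ℝ (fun z => V (u z)) y (b2 j)) =ᶠ[𝓝 x]
        fun y => fderiv ℝ V (u y) (pder u j y) :=
      Filter.eventually_of_mem (hU.mem_nhds hx) (h1 j)
    have h3 : HasFDerivAt (fun y => fderiv ℝ V (u y)) _ x :=
      hd.comp x (hasFDerivAt_of_contDiffOn hU hu.1 hx)
    have h4 := h3.clm_apply (hasFDerivAt_of_contDiffOn hU (pder_contDiffOn hU hu.1 j) hx)
    rw [e.fderiv_eq, h4.fderiv]
    simp [pder, add_comm]
  simp_rw [h2, Finset.sum_add_distrib]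
  have h5 : 0 ≤ ∑ j, fderiv ℝ V (u x) (pder (pder u j) j x) := by
    rw [← map_sum]
    change 0 ≤ fderiv ℝ V (u x) (lap u x)
    rw [hu.2 x hx, map_smul, ← inner_gradient_eq, smul_eq_mul]
    exact mul_nonneg (by positivity) real_inner_self_nonneg
  linarith

/-- A cutoff function equal to `1` on the half disk, with bounded Laplacian. -/
lemma exists_cutoff : ∃ φ : E2 → ℝ, ContDiff ℝ (⊤ : ℕ∞) φ ∧ tsupport φ ⊆ closedBall 0 (5 / 8) ∧
    (∀ x, 0 ≤ φ x) ∧ (∀ x, φ x ≤ 1) ∧ (∀ x ∈ ball (0 : E2) (1 / 2), φ x = 1) ∧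
    ∃ B : ℝ, 0 ≤ B ∧ ∀ x,
      ∑ j, fderiv ℝ (fun y => fderiv ℝ φ y (b2 j)) x (b2 j) ≤ B := by
  let φ : ContDiffBump (0 : E2) := ⟨1 / 2, 5 / 8, by norm_num, by norm_num⟩
  have hφ : ContDiff ℝ (⊤ : ℕ∞) φ := φ.contDiff
  have hc : ∀ j, ContDiff ℝ (⊤ : ℕ∞) fun x =>
      fderiv ℝ (fun y => fderiv ℝ φ y (b2 j)) x (b2 j) := fun j =>
    contDiffOn_univ.1 (contDiffOn_fderiv_apply isOpen_univ
      (contDiffOn_fderiv_apply isOpen_univ hφ.contDiffOn _) _)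
  have hs : ∀ j, HasCompactSupport fun x =>
      fderiv ℝ (fun y => fderiv ℝ φ y (b2 j)) x (b2 j) := fun j =>
    (φ.hasCompactSupport.fderiv_apply ℝ (b2 j)).fderiv_apply ℝ (b2 j)
  choose B hB using fun j => (hs j).exists_bound_of_continuous (hc j).continuous
  refine ⟨φ, hφ, φ.tsupport_eq.subset, fun x => φ.nonneg, fun x => φ.le_one, fun x hx =>
    φ.one_of_mem_closedBall (ball_subset_closedBall hx), ∑ j, B j,
    Finset.sum_nonneg fun j _ => (norm_nonneg _).trans (hB j 0), fun x =>
    Finset.sum_le_sum fun j _ => (Real.le_norm_self _).trans (hB j x)⟩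

/-- The Dirichlet energy on the half disk is bounded by the potential energy. -/
lemma exists_integral_gradSq_le {k : ℕ} {V : Evec k → ℝ} (hV : IsMultiWell V) {L : ℝ}
    (hL : 0 < L) : ∃ A : ℝ, 0 ≤ A ∧ ∀ ε : ℝ, 0 < ε → ε ≤ 1 →
      ∀ u : E2 → Evec k, IsSolution V ε (ball (0 : E2) 1) u →
        (∀ x ∈ ball (0 : E2) (4 / 5), ‖u x‖ ≤ L) →
        ∫ x in ball (0 : E2) (1 / 2), gradSq u x ≤
          A * (ε ^ 2)⁻¹ * ∫ x in ball (0 : E2) (3 / 4), V (u x) := by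
  obtain ⟨C, hC0, hC⟩ := exists_gradSq_le hV.smooth hL
  obtain ⟨c, hc, K, hK0, hK⟩ := hV.exists_hessian_lower_bound L
  obtain ⟨φ, hφ, hφs, hφ0, hφ1, hφ2, B, hB0, hB⟩ := exists_cutoff
  refine ⟨(B + K * C) / c, by positivity, fun ε hε hε1 u hu hub => ?_⟩
  have he : 1 ≤ (ε ^ 2)⁻¹ := (one_le_inv₀ (by positivity)).2 (pow_le_one₀ hε.le hε1)
  set e := (ε ^ 2)⁻¹
  have hO : IsOpen (ball (0 : E2) 1) := isOpen_ball
  have hsub : closedBall (0 : E2) (5 / 8) ⊆ ball 0 1 := closedBall_subset_ball (by norm_num)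
  have hf : ContDiffOn ℝ (⊤ : ℕ∞) (fun x => V (u x)) (ball 0 1) := hV.smooth.comp_contDiffOn hu.1
  have hφz : ∀ x, x ∉ closedBall (0 : E2) (5 / 8) → φ x = 0 := fun x hx =>
    image_eq_zero_of_notMem_tsupport fun h => hx (hφs h)
  have hDf := fun j => (contDiffOn_fderiv_apply hO (contDiffOn_fderiv_apply hO hf (b2 j))
    (b2 j)).continuousOn
  have hDφ : ∀ j, ContDiff ℝ (⊤ : ℕ∞) fun x =>
      fderiv ℝ (fun y => fderiv ℝ φ y (b2 j)) x (b2 j) := fun j =>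
    contDiffOn_univ.1 (contDiffOn_fderiv_apply isOpen_univ
      (contDiffOn_fderiv_apply isOpen_univ hφ.contDiffOn _) _)
  have hDφs : ∀ j, tsupport (fun x => fderiv ℝ (fun y => fderiv ℝ φ y (b2 j)) x (b2 j)) ⊆
      closedBall 0 (5 / 8) := fun j =>
    (tsupport_fderiv_apply_subset ℝ _).trans ((tsupport_fderiv_apply_subset ℝ _).trans hφs)
  have ig := integrable_mul_of_tsupport_subset hφ.continuous hφs (gradSq_continuousOn hO hu.1)
  have iV := integrable_mul_of_tsupport_subset hφ.continuous hφs hf.continuousOn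
  have iD := fun j => integrable_mul_of_tsupport_subset hφ.continuous hφs (hDf j)
  have iDφ := fun j => integrable_mul_of_tsupport_subset (hDφ j).continuous (hDφs j)
    hf.continuousOn
  have pointwise : ∀ x, c * (φ x * gradSq u x) ≤
      (∑ j, φ x * fderiv ℝ (fun y => fderiv ℝ (fun z => V (u z)) y (b2 j)) x (b2 j))
        + K * C * e * (φ x * V (u x)) := by
    intro x
    by_cases hx : x ∈ closedBall (0 : E2) (5 / 8)
    · have hux : ‖u x‖ ≤ L := hub x (closedBall_subset_ball (by norm_num) hx)
      have h1 := hu.sum_hessian_le hV.smooth hO (hsub hx)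
      have h2 : c * gradSq u x ≤
          ∑ j, fderiv ℝ (fderiv ℝ V) (u x) (pder u j x) (pder u j x)
            + K * V (u x) * gradSq u x := by
        rw [gradSq, Finset.mul_sum, Finset.mul_sum, ← Finset.sum_add_distrib]
        exact Finset.sum_le_sum fun j _ => hK _ hux _
      have h3 := hC ε hε hε1 u hu hub x (closedBall_subset_closedBall (by norm_num) hx)
      have h4 := mul_le_mul_of_nonneg_left h3 (mul_nonneg hK0 (hV.nonneg (u x)))
      rw [← Finset.mul_sum]
      have h5 : c * gradSq u x ≤
          ∑ j, fderiv ℝ (fun y => fderiv ℝ (fun z => V (u z)) y (b2 j)) x (b2 j)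
            + K * V (u x) * (C * e) := by linarith
      have := mul_le_mul_of_nonneg_left h5 (hφ0 x)
      linarith
    · simp [hφz x hx]
  have hint : c * ∫ x, φ x * gradSq u x ≤
      ∫ x, ((∑ j, fderiv ℝ (fun y => fderiv ℝ φ y (b2 j)) x (b2 j) * V (u x))
        + K * C * e * (φ x * V (u x))) := by
    rw [← integral_const_mul]
    refine (integral_mono (ig.const_mul c)
      ((integrable_finsetSum _ fun j _ => iD j).add (iV.const_mul _)) pointwise).trans_eq ?_
    simp only [Pi.add_apply]
    rw [integral_add (integrable_finsetSum _ fun j _ => iD j) (iV.const_mul _),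
      integral_add (integrable_finsetSum _ fun j _ => iDφ j) (iV.const_mul _),
      integral_finsetSum _ fun j _ => iD j, integral_finsetSum _ fun j _ => iDφ j]
    congr 1
    exact Finset.sum_congr rfl fun j _ => integral_mul_fderiv_fderiv_eq hφ hφs hf (b2 j)
  have hbound : ∫ x, ((∑ j, fderiv ℝ (fun y => fderiv ℝ φ y (b2 j)) x (b2 j) * V (u x))
        + K * C * e * (φ x * V (u x))) ≤
      (B + K * C) * e * ∫ x in ball (0 : E2) (3 / 4), V (u x) := by
    have iR : Integrable fun x => (∑ j, fderiv ℝ (fun y => fderiv ℝ φ y (b2 j)) x (b2 j) * V (u x))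
        + K * C * e * (φ x * V (u x)) :=
      (integrable_finsetSum _ fun j _ => iDφ j).add (iV.const_mul _)
    rw [← setIntegral_eq_integral_of_forall_compl_eq_zero (s := ball (0 : E2) (3 / 4)),
      ← integral_const_mul]
    · refine setIntegral_mono iR.integrableOn ?_ fun x => ?_
      · exact (((hf.continuousOn.mono (closedBall_subset_ball (by norm_num))).integrableOn_compact
          (isCompact_closedBall 0 (3 / 4))).mono_set ball_subset_closedBall).const_mul _
      · rw [← Finset.sum_mul]
        have h1 := mul_le_mul_of_nonneg_right (hB x) (hV.nonneg (u x))
        have h2 : K * C * e * (φ x * V (u x)) ≤ K * C * e * (1 * V (u x)) := by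
          have := hV.nonneg (u x)
          have := hφ1 x
          gcongr
        have h3 : B * V (u x) ≤ B * e * V (u x) := by
          have := hV.nonneg (u x)
          gcongr
          nlinarith
        linarith
    · intro x hx
      have hx' : x ∉ closedBall (0 : E2) (5 / 8) := fun h =>
        hx (closedBall_subset_ball (by norm_num) h)
      have h1 : ∀ j, fderiv ℝ (fun y => fderiv ℝ φ y (b2 j)) x (b2 j) = 0 := fun j =>
        image_eq_zero_of_notMem_tsupport
          (f := fun x => fderiv ℝ (fun y => fderiv ℝ φ y (b2 j)) x (b2 j))
          fun h => hx' (hDφs j h)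
      simp [h1, hφz x hx']
  have hleft : ∫ x in ball (0 : E2) (1 / 2), gradSq u x ≤ ∫ x, φ x * gradSq u x := by
    rw [setIntegral_congr_fun (g := fun x => φ x * gradSq u x) measurableSet_ball
      fun x hx => by simp [hφ2 x hx]]
    exact setIntegral_le_integral ig
      (Eventually.of_forall fun x => mul_nonneg (hφ0 x) (gradSq_nonneg u x))
  have := mul_le_mul_of_nonneg_left hleft hc.le
  rw [div_mul_eq_mul_div, div_mul_eq_mul_div, le_div_iff₀ hc]
  linarith

/-- energy bounded by the potential. For every `L > 0`
there is `K_pot(L) > 0` depending only on `V` and `L` such that any solution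
on the unit disk with `sup_{D²(4/5)} |u_ε| ≤ L` satisfies
`∫_{D²(1/2)} e_ε(u_ε) ≤ K_pot(L)·[∫_{D²(3/4)} ε⁻¹V(u_ε) + ε·∫_{D²∖D²(3/4)} e_ε(u_ε)]`. -/
theorem statement_19 (k : ℕ) (hk : 1 ≤ k) (V : Evec k → ℝ) (hV : IsMultiWell V)
    (L : ℝ) (hL : 0 < L) :
    ∃ Kpot > (0 : ℝ),
      ∀ ε : ℝ, 0 < ε → ε ≤ 1 →
      ∀ u : E2 → Evec k, IsSolution V ε (ball (0 : E2) 1) u →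
        IntegrableOn (eDens V ε u) (ball (0 : E2) 1) →
        (∀ x ∈ ball (0 : E2) (4 / 5), ‖u x‖ ≤ L) →
        energy V ε u (ball (0 : E2) (1 / 2)) ≤
          Kpot * ((∫ x in ball (0 : E2) (3 / 4), ε⁻¹ * V (u x)) +
            ε * energy V ε u (ball (0 : E2) 1 \ ball (0 : E2) (3 / 4))) := by
  obtain ⟨A, hA0, hA⟩ := exists_integral_gradSq_le hV hL
  refine ⟨A / 2 + 1, by positivity, fun ε hε hε1 u hu _ hub => ?_⟩
  have hO : IsOpen (ball (0 : E2) 1) := isOpen_ball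
  have hf : ContinuousOn (fun x => V (u x)) (ball 0 1) :=
    hV.smooth.continuous.comp_continuousOn hu.1.continuousOn
  have hi : ∀ {g : E2 → ℝ}, ContinuousOn g (ball 0 1) → ∀ {r : ℝ}, r < 1 →
      IntegrableOn g (ball (0 : E2) r) := fun hg r hr =>
    ((hg.mono (closedBall_subset_ball hr)).integrableOn_compact
      (isCompact_closedBall 0 r)).mono_set ball_subset_closedBall
  have ig := hi (gradSq_continuousOn hO hu.1) (r := 1 / 2) (by norm_num)
  have iV := hi hf (r := 1 / 2) (by norm_num)
  have iV' := hi hf (r := 3 / 4) (by norm_num)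
  have hE : energy V ε u (ball (0 : E2) (1 / 2)) =
      ε / 2 * (∫ x in ball (0 : E2) (1 / 2), gradSq u x)
        + ε⁻¹ * ∫ x in ball (0 : E2) (1 / 2), V (u x) := by
    rw [← integral_const_mul, ← integral_const_mul,
      ← integral_add (ig.const_mul _) (iV.const_mul _)]
    rfl
  have hrest : 0 ≤ energy V ε u (ball (0 : E2) 1 \ ball (0 : E2) (3 / 4)) :=
    integral_nonneg fun x => by
      have := gradSq_nonneg u x
      have := hV.nonneg (u x)
      simp only [eDens, Pi.zero_apply]
      positivity
  have hmono : ∫ x in ball (0 : E2) (1 / 2), V (u x) ≤ ∫ x in ball (0 : E2) (3 / 4), V (u x) :=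
    setIntegral_mono_set iV' (Eventually.of_forall fun x => hV.nonneg (u x))
      (ball_subset_ball (by norm_num)).eventuallyLE
  have hg := mul_le_mul_of_nonneg_left (hA ε hε hε1 u hu hub) (by positivity : 0 ≤ ε / 2)
  have hm := mul_le_mul_of_nonneg_left hmono (by positivity : 0 ≤ ε⁻¹)
  have hr : 0 ≤ (A / 2 + 1) * (ε * energy V ε u (ball (0 : E2) 1 \ ball (0 : E2) (3 / 4))) := by
    positivity
  rw [hE, integral_const_mul]
  have hs : ε / 2 * (A * (ε ^ 2)⁻¹ * ∫ x in ball (0 : E2) (3 / 4), V (u x)) =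
      A / 2 * (ε⁻¹ * ∫ x in ball (0 : E2) (3 / 4), V (u x)) := by
    field_simp
  rw [hs] at hg
  linarith
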